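/- arXiv:2408.16656 — 7 statements merged into one kernel-verified Lean document; each statement's English description precedes it below -/
import Mathlib

section
/- Let 1 ≤ m ≤ n, let J ∈ ℝ^{m×n}, and let H ∈ ℝ^{n×n} satisfy ‖H‖ ≤ κ_H (operator norm induced by the Euclidean norm) and uᵀHu ≥ ζ‖u‖² for every u ∈ ℝ^n with Ju = 0, where ζ, κ_H > 0. Suppose w ∈ ℝ^n, c ∈ ℝ^m, y ∈ ℝ^m and u, v ∈ ℝ^n satisfy H(u + v) + Jᵀy = −w, Ju = 0, and ‖v‖ ≤ κ_v‖c‖ for some κ_v > 0. Then ζ‖u‖ ≤ ‖w‖ + κ_Hκ_v‖c‖, i.e., ‖u‖ ≤ ζ⁻¹‖w‖ + ζ⁻¹κ_Hκ_v‖c‖. In particular, if additionally ‖w‖ ≤ κ_g and ‖c‖ ≤ κ_c, then ‖u‖ ≤ κ_u := ζ⁻¹κ_g + ζ⁻¹κ_Hκ_vκ_c. -/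
open Matrix RealInnerProductSpace

/-- A vector in the kernel of `J` is orthogonal to the range of `Jᵀ`. -/
theorem inner_toEuclideanLin_transpose_eq_zero {m n : ℕ} (J : Matrix (Fin m) (Fin n) ℝ)
    {u : EuclideanSpace ℝ (Fin n)} (hu : Matrix.toEuclideanLin J u = 0)
    (y : EuclideanSpace ℝ (Fin m)) : ⟪u, Matrix.toEuclideanLin Jᵀ y⟫ = 0 := by
  rw [← Matrix.conjTranspose_eq_transpose_of_trivial,
    Matrix.toEuclideanLin_conjTranspose_eq_adjoint, LinearMap.adjoint_inner_right, hu,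
    inner_zero_left]

/-- Bound on the tangential component of the Newton–SQP step:
`ζ ‖u‖ ≤ ‖w‖ + κ_H κ_v ‖c‖`, hence `‖u‖ ≤ ζ⁻¹‖w‖ + ζ⁻¹κ_H κ_v ‖c‖`; and if moreover
`‖w‖ ≤ κ_g` and `‖c‖ ≤ κ_c`, then `‖u‖ ≤ κ_u := ζ⁻¹κ_g + ζ⁻¹κ_H κ_v κ_c`. -/
theorem stmt1 {m n : ℕ} (hm : 1 ≤ m) (hmn : m ≤ n)
    (J : Matrix (Fin m) (Fin n) ℝ) (H : Matrix (Fin n) (Fin n) ℝ)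
    (ζ κH κv : ℝ) (hζ : 0 < ζ) (hκH : 0 < κH) (hκv : 0 < κv)
    (hHnorm : ∀ z : EuclideanSpace ℝ (Fin n), ‖Matrix.toEuclideanLin H z‖ ≤ κH * ‖z‖)
    (hHpd : ∀ z : EuclideanSpace ℝ (Fin n), Matrix.toEuclideanLin J z = 0 →
      ζ * ‖z‖ ^ 2 ≤ ⟪z, Matrix.toEuclideanLin H z⟫)
    (w u v : EuclideanSpace ℝ (Fin n)) (c y : EuclideanSpace ℝ (Fin m))
    (hsys : Matrix.toEuclideanLin H (u + v) + Matrix.toEuclideanLin Jᵀ y = -w)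
    (hJu : Matrix.toEuclideanLin J u = 0)
    (hv : ‖v‖ ≤ κv * ‖c‖) :
    ζ * ‖u‖ ≤ ‖w‖ + κH * κv * ‖c‖ ∧
    ‖u‖ ≤ ζ⁻¹ * ‖w‖ + ζ⁻¹ * κH * κv * ‖c‖ ∧
    (∀ κg κc : ℝ, ‖w‖ ≤ κg → ‖c‖ ≤ κc →
      ‖u‖ ≤ ζ⁻¹ * κg + ζ⁻¹ * κH * κv * κc) := by
  have bound : ζ * ‖u‖ ≤ ‖w‖ + κH * κv * ‖c‖ := by
    have key : ⟪u, Matrix.toEuclideanLin H u⟫ = -⟪u, w⟫ - ⟪u, Matrix.toEuclideanLin H v⟫ := by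
      have h := congrArg (fun z => ⟪u, z⟫) hsys
      simp only [map_add, inner_add_right, inner_neg_right,
        inner_toEuclideanLin_transpose_eq_zero J hJu] at h
      linarith
    have hw := (abs_le.mp (abs_real_inner_le_norm u w)).1
    have hHv := (abs_le.mp (abs_real_inner_le_norm u (Matrix.toEuclideanLin H v))).1
    have hv' : ‖Matrix.toEuclideanLin H v‖ ≤ κH * κv * ‖c‖ := by
      calc ‖Matrix.toEuclideanLin H v‖ ≤ κH * ‖v‖ := hHnorm v
        _ ≤ κH * (κv * ‖c‖) := by gcongr
        _ = κH * κv * ‖c‖ := by ring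
    rcases (norm_nonneg u).eq_or_lt with hu | hu
    · rw [← hu, mul_zero]
      positivity
    · refine le_of_mul_le_mul_left ?_ hu
      have := mul_le_mul_of_nonneg_left hv' hu.le
      linarith [hHpd u hJu]
  have bound_inv : ‖u‖ ≤ ζ⁻¹ * ‖w‖ + ζ⁻¹ * κH * κv * ‖c‖ := by
    calc ‖u‖ ≤ ζ⁻¹ * (‖w‖ + κH * κv * ‖c‖) := (le_inv_mul_iff₀ hζ).mpr bound
      _ = ζ⁻¹ * ‖w‖ + ζ⁻¹ * κH * κv * ‖c‖ := by ring
  refine ⟨bound, bound_inv, fun κg κc hw hc => bound_inv.trans ?_⟩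
  gcongr
end

section
/- Let 1 ≤ m ≤ n, let J ∈ ℝ^{m×n}, and let H ∈ ℝ^{n×n} satisfy ‖H‖ ≤ κ_H for κ_H > 0. Suppose w ∈ ℝ^n, c ∈ ℝ^m, y ∈ ℝ^m and u, v ∈ ℝ^n satisfy H(u + v) + Jᵀy = −w and Ju = 0, together with the bounds ‖w‖ ≤ κ_g, ‖u‖ ≤ κ_u, and ‖v‖ ≤ κ_v·‖c‖₁ for constants κ_g, κ_u, κ_v > 0. Let σ ∈ (0,1), let β satisfy 0 < β ≤ κ_β, set d := βu + v and τ_min := (1−σ)/(κ_v(κ_βκ_Hκ_u + κ_g)). Then τ_min·(wᵀd + β·uᵀHu) ≤ (1−σ)·‖c‖₁. -/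
open Matrix RealInnerProductSpace

/-- The ℓ¹-norm of a vector in `ℝ^m`. -/
noncomputable def l1Norm {k : ℕ} (v : EuclideanSpace ℝ (Fin k)) : ℝ := ∑ i, |v i|

/-- The real transpose is the adjoint for the Euclidean inner products. -/
theorem inner_toEuclideanLin_transpose {m n : ℕ} (A : Matrix (Fin m) (Fin n) ℝ)
    (x : EuclideanSpace ℝ (Fin n)) (y : EuclideanSpace ℝ (Fin m)) :
    ⟪x, Matrix.toEuclideanLin Aᵀ y⟫ = ⟪Matrix.toEuclideanLin A x, y⟫ := by
  rw [← Matrix.conjTranspose_eq_transpose_of_trivial,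
    Matrix.toEuclideanLin_conjTranspose_eq_adjoint, LinearMap.adjoint_inner_right]

/-- The merit-parameter inequality: with
`τ_min = (1-σ)/(κ_v(κ_β κ_H κ_u + κ_g))` and `d = β u + v`, one has
`τ_min (wᵀd + β uᵀHu) ≤ (1-σ) ‖c‖₁`. -/
theorem stmt2 {m n : ℕ} (hm : 1 ≤ m) (hmn : m ≤ n)
    (J : Matrix (Fin m) (Fin n) ℝ) (H : Matrix (Fin n) (Fin n) ℝ)
    (κH κg κu κv κβ σ β : ℝ)
    (hκH : 0 < κH) (hκg : 0 < κg) (hκu : 0 < κu) (hκv : 0 < κv)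
    (hHnorm : ∀ z : EuclideanSpace ℝ (Fin n), ‖Matrix.toEuclideanLin H z‖ ≤ κH * ‖z‖)
    (w u v : EuclideanSpace ℝ (Fin n)) (c y : EuclideanSpace ℝ (Fin m))
    (hsys : Matrix.toEuclideanLin H (u + v) + Matrix.toEuclideanLin Jᵀ y = -w)
    (hJu : Matrix.toEuclideanLin J u = 0)
    (hw : ‖w‖ ≤ κg) (hu : ‖u‖ ≤ κu) (hv : ‖v‖ ≤ κv * l1Norm c)
    (hσ : σ ∈ Set.Ioo (0 : ℝ) 1) (hβ : 0 < β) (hβκ : β ≤ κβ) :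
    (1 - σ) / (κv * (κβ * κH * κu + κg)) *
        (⟪w, β • u + v⟫ + β * ⟪u, Matrix.toEuclideanLin H u⟫)
      ≤ (1 - σ) * l1Norm c := by
  have hκβ : 0 < κβ := hβ.trans_le hβκ
  have hσ' : 0 < 1 - σ := sub_pos.mpr hσ.2
  have hwu : ⟪u, Matrix.toEuclideanLin H u⟫ + ⟪u, Matrix.toEuclideanLin H v⟫ = -⟪w, u⟫ := by
    have h := congrArg (fun z => ⟪u, z⟫) hsys
    simpa [inner_add_right, inner_toEuclideanLin_transpose, hJu, real_inner_comm] using h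
  have hwv : ⟪w, v⟫ ≤ κg * ‖v‖ :=
    (real_inner_le_norm w v).trans (by gcongr)
  have hHv : -⟪u, Matrix.toEuclideanLin H v⟫ ≤ κu * (κH * ‖v‖) :=
    calc -⟪u, Matrix.toEuclideanLin H v⟫
        ≤ ‖u‖ * ‖Matrix.toEuclideanLin H v‖ :=
          (neg_le_abs _).trans (abs_real_inner_le_norm _ _)
      _ ≤ κu * (κH * ‖v‖) := by gcongr; exact hHnorm v
  have hmodel : ⟪w, β • u + v⟫ + β * ⟪u, Matrix.toEuclideanLin H u⟫
      ≤ κv * (κβ * κH * κu + κg) * l1Norm c :=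
    calc ⟪w, β • u + v⟫ + β * ⟪u, Matrix.toEuclideanLin H u⟫
        = ⟪w, v⟫ + β * -⟪u, Matrix.toEuclideanLin H v⟫ := by
          rw [inner_add_right, real_inner_smul_right]
          linear_combination β * hwu
      _ ≤ κg * ‖v‖ + β * (κu * (κH * ‖v‖)) := by gcongr
      _ ≤ κg * ‖v‖ + κβ * (κu * (κH * ‖v‖)) := by gcongr
      _ = (κβ * κH * κu + κg) * ‖v‖ := by ring
      _ ≤ (κβ * κH * κu + κg) * (κv * l1Norm c) := by gcongr
      _ = κv * (κβ * κH * κu + κg) * l1Norm c := by ring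
  calc (1 - σ) / (κv * (κβ * κH * κu + κg)) *
        (⟪w, β • u + v⟫ + β * ⟪u, Matrix.toEuclideanLin H u⟫)
      ≤ (1 - σ) / (κv * (κβ * κH * κu + κg)) *
        (κv * (κβ * κH * κu + κg) * l1Norm c) := by gcongr
    _ = (1 - σ) * l1Norm c := by field_simp
end

section
/- Let 1 ≤ m ≤ n, let J ∈ ℝ^{m×n}, and let H ∈ ℝ^{n×n} satisfy ‖H‖ ≤ κ_H for κ_H > 0. Suppose w ∈ ℝ^n, c ∈ ℝ^m, y ∈ ℝ^m and u, v ∈ ℝ^n satisfy H(u + v) + Jᵀy = −w and Ju = 0, together with the bounds ‖w‖ ≤ κ_g, ‖u‖ ≤ κ_u, and ‖v‖ ≤ κ_v·‖c‖₁ for constants κ_g, κ_u, κ_v > 0. Let σ ∈ (0,1), let β satisfy 0 < β ≤ κ_β, set d := βu + v and τ_min := (1−σ)/(κ_v(κ_βκ_Hκ_u + κ_g)). Then the model reduction Δl := −τ_min·wᵀd + ‖c‖₁ satisfies Δl ≥ τ_min·β·uᵀHu + σ·‖c‖₁. -/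
open Matrix RealInnerProductSpace

/-- Lower bound on the model reduction: with
`τ_min = (1-σ)/(κ_v(κ_β κ_H κ_u + κ_g))` and `d = β u + v`, the reduction
`Δl := -τ_min wᵀd + ‖c‖₁` satisfies `Δl ≥ τ_min β uᵀHu + σ ‖c‖₁`. -/
theorem stmt3 {m n : ℕ} (hm : 1 ≤ m) (hmn : m ≤ n)
    (J : Matrix (Fin m) (Fin n) ℝ) (H : Matrix (Fin n) (Fin n) ℝ)
    (κH κg κu κv κβ σ β : ℝ)
    (hκH : 0 < κH) (hκg : 0 < κg) (hκu : 0 < κu) (hκv : 0 < κv)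
    (hHnorm : ∀ z : EuclideanSpace ℝ (Fin n), ‖Matrix.toEuclideanLin H z‖ ≤ κH * ‖z‖)
    (w u v : EuclideanSpace ℝ (Fin n)) (c y : EuclideanSpace ℝ (Fin m))
    (hsys : Matrix.toEuclideanLin H (u + v) + Matrix.toEuclideanLin Jᵀ y = -w)
    (hJu : Matrix.toEuclideanLin J u = 0)
    (hw : ‖w‖ ≤ κg) (hu : ‖u‖ ≤ κu) (hv : ‖v‖ ≤ κv * l1Norm c)
    (hσ : σ ∈ Set.Ioo (0 : ℝ) 1) (hβ : 0 < β) (hβκ : β ≤ κβ) :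
    -((1 - σ) / (κv * (κβ * κH * κu + κg)) * ⟪w, β • u + v⟫) + l1Norm c
      ≥ (1 - σ) / (κv * (κβ * κH * κu + κg)) * β * ⟪u, Matrix.toEuclideanLin H u⟫
        + σ * l1Norm c := by
  have hadj : ⟪u, Matrix.toEuclideanLin Jᵀ y⟫ = 0 := by
    rw [← conjTranspose_eq_transpose_of_trivial, Matrix.toEuclideanLin_conjTranspose_eq_adjoint,
      LinearMap.adjoint_inner_right, hJu, inner_zero_left]
  have hexpand : -⟪w, β • u + v⟫ = β * ⟪u, Matrix.toEuclideanLin H u⟫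
      + (β * ⟪u, Matrix.toEuclideanLin H v⟫ - ⟪w, v⟫) := by
    have h := congrArg (fun z => ⟪u, z⟫) hsys
    simp only [map_add, inner_add_right, inner_neg_right, hadj] at h
    rw [inner_add_right, inner_smul_right, real_inner_comm u w]
    linear_combination (-β) * h
  have hHv : -(κu * (κH * ‖v‖)) ≤ ⟪u, Matrix.toEuclideanLin H v⟫ := by
    refine (neg_le_neg ?_).trans (neg_le_of_abs_le (abs_real_inner_le_norm _ _))
    exact mul_le_mul hu (hHnorm v) (norm_nonneg _) hκu.le
  have hwv : ⟪w, v⟫ ≤ κg * ‖v‖ :=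
    (real_inner_le_norm w v).trans (mul_le_mul_of_nonneg_right hw (norm_nonneg v))
  have hκβ : 0 < κβ := hβ.trans_le hβκ
  have hK : 0 < κβ * κH * κu + κg := by positivity
  have hτ : 0 ≤ (1 - σ) / (κv * (κβ * κH * κu + κg)) :=
    div_nonneg (by linarith [hσ.2]) (by positivity)
  have hcross : -((κβ * κH * κu + κg) * (κv * l1Norm c))
      ≤ β * ⟪u, Matrix.toEuclideanLin H v⟫ - ⟪w, v⟫ := by
    have h₁ := mul_le_mul_of_nonneg_left hHv hβ.le
    have h₂ : β * (κu * (κH * ‖v‖)) ≤ κβ * (κu * (κH * ‖v‖)) :=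
      mul_le_mul_of_nonneg_right hβκ (by positivity)
    have h₃ := mul_le_mul_of_nonneg_left hv hK.le
    linarith
  have hscaled := mul_le_mul_of_nonneg_left hcross hτ
  have hcancel : (1 - σ) / (κv * (κβ * κH * κu + κg)) *
      -((κβ * κH * κu + κg) * (κv * l1Norm c)) = -((1 - σ) * l1Norm c) := by
    field_simp
  rw [hcancel] at hscaled
  rw [← mul_neg, hexpand]
  linarith
end

section
/- Let 1 ≤ m ≤ n, let J ∈ ℝ^{m×n}, and let H ∈ ℝ^{n×n} satisfy ‖H‖ ≤ κ_H and uᵀHu ≥ ζ‖u‖² for every u ∈ ℝ^n with Ju = 0, where ζ, κ_H > 0. Suppose w ∈ ℝ^n, c ∈ ℝ^m, y ∈ ℝ^m and u, v ∈ ℝ^n satisfy H(u + v) + Jᵀy = −w and Ju = 0, together with ‖u‖ ≤ κ_u and max{‖v‖, ‖v‖²} ≤ κ_v·‖c‖₁ for constants κ_u, κ_v > 0. Then uᵀHu ≥ ζκ_H⁻²·‖w + Jᵀy‖² − (1 + 2κ_u)·ζ·κ_v·‖c‖₁. -/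
open Matrix RealInnerProductSpace

/-- Lower bound on the quadratic term in terms of the gradient of
the Lagrangian: `uᵀHu ≥ ζ κ_H⁻² ‖w + Jᵀy‖² − (1 + 2κ_u) ζ κ_v ‖c‖₁`. -/
theorem stmt4 {m n : ℕ} (hm : 1 ≤ m) (hmn : m ≤ n)
    (J : Matrix (Fin m) (Fin n) ℝ) (H : Matrix (Fin n) (Fin n) ℝ)
    (ζ κH κu κv : ℝ) (hζ : 0 < ζ) (hκH : 0 < κH) (hκu : 0 < κu) (hκv : 0 < κv)
    (hHnorm : ∀ z : EuclideanSpace ℝ (Fin n), ‖Matrix.toEuclideanLin H z‖ ≤ κH * ‖z‖)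
    (hHpd : ∀ z : EuclideanSpace ℝ (Fin n), Matrix.toEuclideanLin J z = 0 →
      ζ * ‖z‖ ^ 2 ≤ ⟪z, Matrix.toEuclideanLin H z⟫)
    (w u v : EuclideanSpace ℝ (Fin n)) (c y : EuclideanSpace ℝ (Fin m))
    (hsys : Matrix.toEuclideanLin H (u + v) + Matrix.toEuclideanLin Jᵀ y = -w)
    (hJu : Matrix.toEuclideanLin J u = 0)
    (hu : ‖u‖ ≤ κu) (hv : max ‖v‖ (‖v‖ ^ 2) ≤ κv * l1Norm c) :
    ⟪u, Matrix.toEuclideanLin H u⟫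
      ≥ ζ * (κH ^ 2)⁻¹ * ‖w + Matrix.toEuclideanLin Jᵀ y‖ ^ 2
        - (1 + 2 * κu) * ζ * κv * l1Norm c := by
  set K := κv * l1Norm c
  have hv₁ : ‖v‖ ≤ K := (le_max_left _ _).trans hv
  have hv₂ : ‖v‖ ^ 2 ≤ K := (le_max_right _ _).trans hv
  have hgrad : w + Matrix.toEuclideanLin Jᵀ y = -Matrix.toEuclideanLin H (u + v) := by
    rw [← neg_eq_iff_eq_neg.mpr hsys]
    abel
  have hnorm : ‖w + Matrix.toEuclideanLin Jᵀ y‖ ≤ κH * (‖u‖ + ‖v‖) := by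
    rw [hgrad, norm_neg]
    exact (hHnorm _).trans (by gcongr; exact norm_add_le u v)
  have hscaled : (κH ^ 2)⁻¹ * ‖w + Matrix.toEuclideanLin Jᵀ y‖ ^ 2 ≤ (‖u‖ + ‖v‖) ^ 2 := by
    rw [inv_mul_le_iff₀ (by positivity), ← mul_pow]
    gcongr
  have hcross : ‖u‖ * ‖v‖ ≤ κu * K := mul_le_mul hu hv₁ (norm_nonneg v) hκu.le
  have hsq : (κH ^ 2)⁻¹ * ‖w + Matrix.toEuclideanLin Jᵀ y‖ ^ 2 - (1 + 2 * κu) * K ≤ ‖u‖ ^ 2 := by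
    linarith [add_sq ‖u‖ ‖v‖]
  calc
    _ = ζ * ((κH ^ 2)⁻¹ * ‖w + Matrix.toEuclideanLin Jᵀ y‖ ^ 2 - (1 + 2 * κu) * K) := by
      simp only [K]
      ring
    _ ≤ ζ * ‖u‖ ^ 2 := by gcongr
    _ ≤ _ := hHpd u hJu
end

section
/- Let 1 ≤ m ≤ n. Let f : ℝ^n → ℝ be differentiable with L-Lipschitz gradient, and let c : ℝ^n → ℝ^m be differentiable with each component gradient ∇c_i being γ_i-Lipschitz; set Γ := γ_1 + ⋯ + γ_m and J(x) := ∇c(x)ᵀ ∈ ℝ^{m×n}. Define the merit function φ(x, τ) := τ·f(x) + ‖c(x)‖₁. Fix x ∈ ℝ^n, τ > 0, α > 0, β > 0, a constant κ_v > 0, and vectors u, v, d_true ∈ ℝ^n with uᵀv = 0, ‖v‖² ≤ κ_v·‖c(x)‖₁, d := βu + v, and J(x)d = −c(x). Then φ(x + αd, τ) − φ(x, τ) ≤ −α·(−τ·∇f(x)ᵀd_true + ‖c(x)‖₁) + (α²β²/2)·(τL + Γ)·‖u‖² + (α²/2)·(κ_v(τL + Γ) + 4)·‖c(x)‖₁ +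 α·τ·∇f(x)ᵀ(d − d_true). -/
open Matrix RealInnerProductSpace

/-- Quadratic bound on the first-order Taylor remainder of a function with Lipschitz gradient. -/
theorem abs_sub_sub_inner_gradient_le {E : Type*} [NormedAddCommGroup E] [InnerProductSpace ℝ E]
    [CompleteSpace E] {f : E → ℝ} {g : E → E} {L : ℝ} (hf : ∀ x, HasGradientAt f (g x) x)
    (hg : ∀ x y, ‖g x - g y‖ ≤ L * ‖x - y‖) (x d : E) :
    |f (x + d) - f x - ⟪g x, d⟫| ≤ L / 2 * ‖d‖ ^ 2 := by
  have hline (t : ℝ) : HasDerivAt (fun s : ℝ => x + s • d) d t := by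
    simpa using ((hasDerivAt_id t).smul_const d).const_add x
  have hrem (t : ℝ) : HasDerivAt (fun s : ℝ => f (x + s • d) - f x - s * ⟪g x, d⟫)
      (⟪g (x + t • d), d⟫ - ⟪g x, d⟫) t := by
    have h := (hf (x + t • d)).hasFDerivAt.comp_hasDerivAt t (hline t)
    simpa using (h.sub_const (f x)).fun_sub ((hasDerivAt_id t).mul_const ⟪g x, d⟫)
  have hquad (t : ℝ) : HasDerivAt (fun s : ℝ => L / 2 * ‖d‖ ^ 2 * s ^ 2) (L * ‖d‖ ^ 2 * t) t := by
    refine ((hasDerivAt_pow 2 t).const_mul (L / 2 * ‖d‖ ^ 2)).congr_deriv ?_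
    push_cast
    ring
  have h := image_norm_le_of_norm_deriv_right_le_deriv_boundary (a := 0) (b := 1)
    (fun t _ => (hrem t).continuousAt.continuousWithinAt)
    (fun t _ => (hrem t).hasDerivWithinAt) (by simp) hquad
    (fun t ht => by
      rw [← inner_sub_left]
      calc ‖⟪g (x + t • d) - g x, d⟫‖ ≤ ‖g (x + t • d) - g x‖ * ‖d‖ := norm_inner_le_norm _ _
        _ ≤ L * ‖x + t • d - x‖ * ‖d‖ := by gcongr; exact hg _ _
        _ = L * ‖d‖ ^ 2 * t := by
          rw [add_sub_cancel_left, norm_smul, Real.norm_of_nonneg ht.1]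
          ring)
    (Set.right_mem_Icc.2 zero_le_one)
  simpa using h

/-- Generic descent lemma for the ℓ¹ merit function
`φ(x, τ) = τ f(x) + ‖c(x)‖₁` along the direction `d = β u + v`. -/
theorem stmt5 {m n : ℕ} (hm : 1 ≤ m) (hmn : m ≤ n)
    (f : EuclideanSpace ℝ (Fin n) → ℝ)
    (gradf : EuclideanSpace ℝ (Fin n) → EuclideanSpace ℝ (Fin n))
    (L : ℝ) (hL : 0 < L)
    (hf : ∀ x, HasGradientAt f (gradf x) x)
    (hfLip : ∀ x x', ‖gradf x - gradf x'‖ ≤ L * ‖x - x'‖)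
    (c : EuclideanSpace ℝ (Fin n) → EuclideanSpace ℝ (Fin m))
    (gradc : Fin m → EuclideanSpace ℝ (Fin n) → EuclideanSpace ℝ (Fin n))
    (γ : Fin m → ℝ) (hγ : ∀ i, 0 < γ i)
    (hc : ∀ i x, HasGradientAt (fun z => c z i) (gradc i x) x)
    (hcLip : ∀ i x x', ‖gradc i x - gradc i x'‖ ≤ γ i * ‖x - x'‖)
    (x : EuclideanSpace ℝ (Fin n)) (τ α β κv : ℝ)
    (hτ : 0 < τ) (hα : 0 < α) (hβ : 0 < β) (hκv : 0 < κv)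
    (u v dtrue : EuclideanSpace ℝ (Fin n))
    (horth : ⟪u, v⟫ = 0)
    (hv : ‖v‖ ^ 2 ≤ κv * l1Norm (c x))
    (hJd : ∀ i, ⟪gradc i x, β • u + v⟫ = -(c x i)) :
    (τ * f (x + α • (β • u + v)) + l1Norm (c (x + α • (β • u + v))))
        - (τ * f x + l1Norm (c x))
      ≤ -(α * (-(τ * ⟪gradf x, dtrue⟫) + l1Norm (c x)))
        + α ^ 2 * β ^ 2 / 2 * (τ * L + ∑ i, γ i) * ‖u‖ ^ 2
        + α ^ 2 / 2 * (κv * (τ * L + ∑ i, γ i) + 4) * l1Norm (c x)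
        + α * τ * ⟪gradf x, (β • u + v) - dtrue⟫ := by
  have hΓ : 0 ≤ ∑ i, γ i := Finset.sum_nonneg fun i _ => (hγ i).le
  have hc_nonneg : 0 ≤ l1Norm (c x) := Finset.sum_nonneg fun i _ => abs_nonneg _
  have hnorm : ‖β • u + v‖ ^ 2 = β ^ 2 * ‖u‖ ^ 2 + ‖v‖ ^ 2 := by
    rw [norm_add_sq_real, real_inner_smul_left, horth, norm_smul, mul_pow, Real.norm_eq_abs, sq_abs]
    ring
  set d := β • u + v
  have hsq : ‖α • d‖ ^ 2 = α ^ 2 * ‖d‖ ^ 2 := by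
    rw [norm_smul, mul_pow, Real.norm_eq_abs, sq_abs]
  have hf_le : f (x + α • d) ≤ f x + α * ⟪gradf x, d⟫ + L / 2 * (α ^ 2 * ‖d‖ ^ 2) := by
    have h := (abs_le.1 (abs_sub_sub_inner_gradient_le hf hfLip x (α • d))).2
    rw [hsq, real_inner_smul_right] at h
    linarith
  have hci_le (i : Fin m) :
      |c (x + α • d) i| ≤ |1 - α| * |c x i| + γ i * (α ^ 2 * ‖d‖ ^ 2 / 2) := by
    have h := abs_sub_sub_inner_gradient_le (hc i) (hcLip i) x (α • d)
    rw [hsq, real_inner_smul_right, hJd] at h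
    rw [← abs_mul]
    calc |c (x + α • d) i|
        = |(1 - α) * c x i + (c (x + α • d) i - c x i - α * -(c x i))| := by ring_nf
      _ ≤ _ := (abs_add_le _ _).trans (by linarith)
  have hc_le : l1Norm (c (x + α • d))
      ≤ |1 - α| * l1Norm (c x) + (∑ i, γ i) * (α ^ 2 * ‖d‖ ^ 2 / 2) := by
    unfold l1Norm
    rw [Finset.mul_sum, Finset.sum_mul, ← Finset.sum_add_distrib]
    exact Finset.sum_le_sum fun i _ => hci_le i
  have hα_le : |1 - α| ≤ 1 - α + 2 * α ^ 2 :=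
    abs_le.2 ⟨by nlinarith [sq_nonneg (α - 1)], by nlinarith [sq_nonneg α]⟩
  have hcα := mul_le_mul_of_nonneg_right hα_le hc_nonneg
  have hfτ := mul_le_mul_of_nonneg_left hf_le hτ.le
  have hvK := mul_le_mul_of_nonneg_left hv
    (show 0 ≤ α ^ 2 / 2 * (τ * L + ∑ i, γ i) by positivity)
  rw [hnorm] at hfτ hc_le
  rw [inner_sub_right]
  linarith
end

section
/- Let 1 ≤ m ≤ n, let J ∈ ℝ^{m×n}, and let H ∈ ℝ^{n×n} satisfy uᵀHu ≥ ζ‖u‖² for every u ∈ ℝ^n with Ju = 0, where ζ > 0. Suppose g, w, u, u', v ∈ ℝ^n and y, y' ∈ ℝ^m satisfy Ju = 0, Ju' = 0, H(u + v) + Jᵀy = −g, and H(u' + v) + Jᵀy' = −w. Then ‖u − u'‖ ≤ ζ⁻¹·‖g − w‖. -/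
open Matrix RealInnerProductSpace

/-- The tangential components of the Newton–SQP solutions with
right-hand sides `g` and `w` (and the same normal component `v`) satisfy
`‖u − u'‖ ≤ ζ⁻¹ ‖g − w‖`. -/
theorem stmt6 {m n : ℕ} (hm : 1 ≤ m) (hmn : m ≤ n)
    (J : Matrix (Fin m) (Fin n) ℝ) (H : Matrix (Fin n) (Fin n) ℝ)
    (ζ : ℝ) (hζ : 0 < ζ)
    (hHpd : ∀ z : EuclideanSpace ℝ (Fin n), Matrix.toEuclideanLin J z = 0 →
      ζ * ‖z‖ ^ 2 ≤ ⟪z, Matrix.toEuclideanLin H z⟫)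
    (g w u u' v : EuclideanSpace ℝ (Fin n)) (y y' : EuclideanSpace ℝ (Fin m))
    (hJu : Matrix.toEuclideanLin J u = 0)
    (hJu' : Matrix.toEuclideanLin J u' = 0)
    (hsys : Matrix.toEuclideanLin H (u + v) + Matrix.toEuclideanLin Jᵀ y = -g)
    (hsys' : Matrix.toEuclideanLin H (u' + v) + Matrix.toEuclideanLin Jᵀ y' = -w) :
    ‖u - u'‖ ≤ ζ⁻¹ * ‖g - w‖ := by
  set z := u - u' with hz_def
  have hJz : toEuclideanLin J z = 0 := by rw [hz_def, map_sub, hJu, hJu', sub_zero]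
  have hHz : toEuclideanLin H z = -(g - w) - toEuclideanLin Jᵀ (y - y') := by
    have h_diff : -(g - w) = -g - -w := by abel
    rw [h_diff, ← hsys, ← hsys', hz_def]
    simp only [map_add, map_sub]
    abel
  have h_orth : ⟪z, toEuclideanLin Jᵀ (y - y')⟫ = 0 := by
    rw [← conjTranspose_eq_transpose_of_trivial, toEuclideanLin_conjTranspose_eq_adjoint,
      LinearMap.adjoint_inner_right, hJz, inner_zero_left]
  have h_sq : ζ * ‖z‖ ^ 2 ≤ ‖z‖ * ‖g - w‖ := by
    refine (hHpd z hJz).trans ?_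
    rw [hHz, inner_sub_right, h_orth, sub_zero]
    simpa only [norm_neg] using real_inner_le_norm z (-(g - w))
  rw [inv_mul_eq_div, le_div_iff₀' hζ]
  rcases (norm_nonneg z).eq_or_lt with h | h
  · rw [← h, mul_zero]
    exact norm_nonneg _
  · exact le_of_mul_le_mul_left (by linarith) h
end

section
/- Let 1 ≤ m ≤ n, let J ∈ ℝ^{m×n} have smallest singular value at least s > 0, and let H ∈ ℝ^{n×n} satisfy ‖H‖ ≤ κ_H and uᵀHu ≥ ζ‖u‖² for every u with Ju = 0, where ζ, κ_H > 0. Fix c ∈ ℝ^m, the unique v ∈ Range(Jᵀ) with Jv = −c, and w ∈ ℝ^n; let (u', y') be the unique pair with Ju' = 0 and H(u' + v) + Jᵀy' = −w. On a probability space, let g : Ω → ℝ^n be an integrable random vector with 𝔼[g] = w and 𝔼[‖g − w‖²] ≤ M for some M > 0, and for each ω let (u(ω), y(ω)) be the unique pair with Ju(ω) = 0 and H(u(ω) + v) + Jᵀy(ω) = −g(ω). Then: (i) 𝔼[u] = u' and 𝔼[y] = y'; (ii) 𝔼[‖u‖²] ≤ ζ⁻¹·u'ᵀHu' + ζ⁻²·M;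 (iii) 𝔼[‖u − u'‖²] ≤ ζ⁻²·M; and (iv) for any β > 0, setting d := βu + v and d_true := βu' + v, one has 𝔼[d] = d_true and 𝔼[‖d − d_true‖] ≤ β·ζ⁻¹·√M. -/
open Matrix MeasureTheory RealInnerProductSpace

open ProbabilityTheory in
/-- Jensen's inequality for the square: `𝔼[X] ≤ √(𝔼[X²])`. -/
theorem integral_le_sqrt_integral_sq {Ω : Type*} [MeasurableSpace Ω] {μ : Measure Ω}
    [IsProbabilityMeasure μ] {X : Ω → ℝ} (hX : MemLp X 2 μ) :
    ∫ ω, X ω ∂μ ≤ Real.sqrt (∫ ω, X ω ^ 2 ∂μ) := by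
  apply Real.le_sqrt_of_sq_le
  have h := variance_nonneg X μ
  rw [variance_eq_sub hX] at h
  simpa using h

/-- Bias-variance decomposition of the second moment of a random vector. -/
theorem integral_norm_sq_eq_add {Ω E : Type*} [MeasurableSpace Ω] {μ : Measure Ω}
    [IsProbabilityMeasure μ] [NormedAddCommGroup E] [InnerProductSpace ℝ E] [CompleteSpace E]
    {X : Ω → E} {a : E} (hX : Integrable X μ) (ha : ∫ ω, X ω ∂μ = a)
    (hsq : Integrable (fun ω => ‖X ω - a‖ ^ 2) μ) :
    ∫ ω, ‖X ω‖ ^ 2 ∂μ = ‖a‖ ^ 2 + ∫ ω, ‖X ω - a‖ ^ 2 ∂μ := by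
  have hc : Integrable (fun ω => X ω - a) μ := hX.sub (integrable_const a)
  have hc0 : ∫ ω, (X ω - a) ∂μ = 0 := by
    rw [integral_sub hX (integrable_const a), ha]
    simp
  have hin : Integrable (fun ω => 2 * ⟪a, X ω - a⟫) μ := (hc.const_inner a).const_mul 2
  have hsum : Integrable (fun ω => ‖a‖ ^ 2 + 2 * ⟪a, X ω - a⟫) μ := (integrable_const _).add hin
  have hexp : ∀ ω, ‖X ω‖ ^ 2 = ‖a‖ ^ 2 + 2 * ⟪a, X ω - a⟫ + ‖X ω - a‖ ^ 2 := fun ω => by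
    rw [← norm_add_sq_real, add_sub_cancel]
  simp_rw [hexp]
  rw [integral_add hsum hsq, integral_add (integrable_const _) hin,
    integral_const_mul, integral_inner hc, hc0]
  simp

section SaddlePoint

variable {E F : Type*} [NormedAddCommGroup E] [InnerProductSpace ℝ E]
  [NormedAddCommGroup F] [InnerProductSpace ℝ F]
  {H : E →ₗ[ℝ] E} {J : E →ₗ[ℝ] F} {B : F →ₗ[ℝ] E} {ζ : ℝ}

/-- The primal solution of a saddle-point system is bounded by the right-hand side. -/
theorem norm_le_of_saddlePoint (hζ : 0 < ζ) (hB : ∀ x z, ⟪x, B z⟫ = ⟪J x, z⟫)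
    (hpd : ∀ x, J x = 0 → ζ * ‖x‖ ^ 2 ≤ ⟪x, H x⟫) {x r : E} {z : F} (hx : J x = 0)
    (hr : H x + B z = r) : ‖x‖ ≤ ζ⁻¹ * ‖r‖ := by
  have h1 : ⟪x, H x⟫ = ⟪x, r⟫ := by
    rw [← hr, inner_add_right, hB, hx, inner_zero_left, add_zero]
  have h2 : ζ * ‖x‖ ^ 2 ≤ ‖x‖ * ‖r‖ := by
    have := hpd x hx
    rw [h1] at this
    exact this.trans (real_inner_le_norm x r)
  rw [inv_mul_eq_div, le_div_iff₀ hζ]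
  rcases (norm_nonneg x).eq_or_lt with h | h
  · rw [← h, zero_mul]
    exact norm_nonneg r
  · nlinarith

/-- Solutions of a saddle-point system depend linearly on the right-hand side. -/
theorem exists_saddlePoint_solution_map (hζ : 0 < ζ) (hB : ∀ x z, ⟪x, B z⟫ = ⟪J x, z⟫)
    (hpd : ∀ x, J x = 0 → ζ * ‖x‖ ^ 2 ≤ ⟪x, H x⟫) (hinj : Function.Injective B) :
    ∃ (S : E →ₗ[ℝ] E) (T : E →ₗ[ℝ] F), ∀ x z r, J x = 0 → H x + B z = r →
      x = S r ∧ z = T r := by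
  let K : E × F →ₗ[ℝ] E × F := (H.coprod B).prod (J.comp (LinearMap.fst ℝ E F))
  have hK : LinearMap.ker K = ⊥ := by
    rw [LinearMap.ker_eq_bot']
    rintro ⟨x, z⟩ h
    have h1 : H x + B z = 0 := congrArg Prod.fst h
    have h2 : J x = 0 := congrArg Prod.snd h
    have hx : x = 0 := by simpa using norm_le_of_saddlePoint hζ hB hpd h2 h1
    subst hx
    have hz : z = 0 := hinj (by simpa using h1)
    rw [hz, Prod.mk_zero_zero]
  obtain ⟨L, hL⟩ := K.exists_leftInverse_of_injective hK
  refine ⟨LinearMap.fst ℝ E F ∘ₗ L ∘ₗ LinearMap.inl ℝ E F,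
    LinearMap.snd ℝ E F ∘ₗ L ∘ₗ LinearMap.inl ℝ E F, fun x z r hx hr => ?_⟩
  have h : L (r, 0) = (x, z) := by
    rw [← hr, ← hx]
    exact LinearMap.congr_fun hL (x, z)
  simp [h]

end SaddlePoint

/-- A linear image of a centered random vector, translated by `a`, is integrable with mean `a`. -/
theorem integrable_and_integral_eq_of_sub_eq_linear {Ω E F : Type*} [MeasurableSpace Ω]
    {μ : Measure Ω} [IsProbabilityMeasure μ] [NormedAddCommGroup E] [NormedSpace ℝ E]
    [FiniteDimensional ℝ E] [NormedAddCommGroup F] [NormedSpace ℝ F] [CompleteSpace F]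
    {X : Ω → E} {Y : Ω → F} {a : F} (T : E →ₗ[ℝ] F) (hX : Integrable X μ)
    (hX0 : ∫ ω, X ω ∂μ = 0) (hY : ∀ ω, Y ω - a = T (X ω)) :
    Integrable Y μ ∧ ∫ ω, Y ω ∂μ = a := by
  have : CompleteSpace E := FiniteDimensional.complete ℝ E
  let T' : E →L[ℝ] F := LinearMap.toContinuousLinearMap T
  have hY' : Y = fun ω => a + T' (X ω) := funext fun ω => eq_add_of_sub_eq' (hY ω)
  have hT : Integrable (fun ω => T' (X ω)) μ := T'.integrable_comp hX
  subst hY'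
  refine ⟨(integrable_const a).add hT, ?_⟩
  rw [integral_add (integrable_const a) hT, T'.integral_comp_comm hX, hX0]
  simp

/-- Expectation properties of the stochastic SQP step. -/
theorem stmt7 {m n : ℕ} (hm : 1 ≤ m) (hmn : m ≤ n)
    {Ω : Type*} [MeasurableSpace Ω] (μ : Measure Ω) [IsProbabilityMeasure μ]
    (J : Matrix (Fin m) (Fin n) ℝ) (H : Matrix (Fin n) (Fin n) ℝ)
    (s ζ κH M : ℝ) (hs : 0 < s) (hζ : 0 < ζ) (hκH : 0 < κH) (hM : 0 < M)
    (hsv : ∀ z : EuclideanSpace ℝ (Fin m), s * ‖z‖ ≤ ‖Matrix.toEuclideanLin Jᵀ z‖)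
    (hHnorm : ∀ z : EuclideanSpace ℝ (Fin n), ‖Matrix.toEuclideanLin H z‖ ≤ κH * ‖z‖)
    (hHpd : ∀ z : EuclideanSpace ℝ (Fin n), Matrix.toEuclideanLin J z = 0 →
      ζ * ‖z‖ ^ 2 ≤ ⟪z, Matrix.toEuclideanLin H z⟫)
    (c : EuclideanSpace ℝ (Fin m)) (v : EuclideanSpace ℝ (Fin n))
    (hvrange : ∃ z : EuclideanSpace ℝ (Fin m), v = Matrix.toEuclideanLin Jᵀ z)
    (hJv : Matrix.toEuclideanLin J v = -c)
    (w u' : EuclideanSpace ℝ (Fin n)) (y' : EuclideanSpace ℝ (Fin m))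
    (hJu' : Matrix.toEuclideanLin J u' = 0)
    (hsys' : Matrix.toEuclideanLin H (u' + v) + Matrix.toEuclideanLin Jᵀ y' = -w)
    (g : Ω → EuclideanSpace ℝ (Fin n))
    (hgint : Integrable g μ)
    (hgmean : ∫ ω, g ω ∂μ = w)
    (hgvarint : Integrable (fun ω => ‖g ω - w‖ ^ 2) μ)
    (hgvar : ∫ ω, ‖g ω - w‖ ^ 2 ∂μ ≤ M)
    (u : Ω → EuclideanSpace ℝ (Fin n)) (y : Ω → EuclideanSpace ℝ (Fin m))
    (hJu : ∀ ω, Matrix.toEuclideanLin J (u ω) = 0)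
    (hsys : ∀ ω, Matrix.toEuclideanLin H (u ω + v) + Matrix.toEuclideanLin Jᵀ (y ω)
      = -(g ω)) :
    (∫ ω, u ω ∂μ = u') ∧ (∫ ω, y ω ∂μ = y') ∧
    (∫ ω, ‖u ω‖ ^ 2 ∂μ ≤ ζ⁻¹ * ⟪u', Matrix.toEuclideanLin H u'⟫ + ζ⁻¹ ^ 2 * M) ∧
    (∫ ω, ‖u ω - u'‖ ^ 2 ∂μ ≤ ζ⁻¹ ^ 2 * M) ∧
    (∀ β : ℝ, 0 < β →
      (∫ ω, (β • u ω + v) ∂μ = β • u' + v) ∧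
      ∫ ω, ‖(β • u ω + v) - (β • u' + v)‖ ∂μ ≤ β * ζ⁻¹ * Real.sqrt M) := by
  have hB : ∀ x z, ⟪x, toEuclideanLin Jᵀ z⟫ = ⟪toEuclideanLin J x, z⟫ := fun x z => by
    rw [← conjTranspose_eq_transpose_of_trivial, toEuclideanLin_conjTranspose_eq_adjoint,
      LinearMap.adjoint_inner_right]
  have hinj : Function.Injective (toEuclideanLin Jᵀ) := by
    refine (injective_iff_map_eq_zero _).2 fun z hz => ?_
    have h := hsv z
    rw [hz, norm_zero] at h
    exact norm_le_zero_iff.1 (nonpos_of_mul_nonpos_right h hs)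
  have hJd : ∀ ω, toEuclideanLin J (u ω - u') = 0 := fun ω => by
    rw [map_sub, hJu, hJu', sub_zero]
  have hd : ∀ ω, toEuclideanLin H (u ω - u') + toEuclideanLin Jᵀ (y ω - y') = w - g ω := by
    intro ω
    have e : w - g ω = -g ω - -w := by abel
    rw [e, ← hsys ω, ← hsys']
    simp only [map_sub, map_add]
    abel
  have hwg : Integrable (fun ω => w - g ω) μ := (integrable_const w).sub hgint
  have hwg0 : ∫ ω, (w - g ω) ∂μ = 0 := by
    rw [integral_sub (integrable_const w) hgint, hgmean]
    simp
  obtain ⟨S, T, hST⟩ := exists_saddlePoint_solution_map hζ hB hHpd hinj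
  obtain ⟨huint, humean⟩ := integrable_and_integral_eq_of_sub_eq_linear S hwg hwg0
    fun ω => (hST _ _ _ (hJd ω) (hd ω)).1
  obtain ⟨-, hymean⟩ := integrable_and_integral_eq_of_sub_eq_linear T hwg hwg0
    fun ω => (hST _ _ _ (hJd ω) (hd ω)).2
  have hbound : ∀ ω, ‖u ω - u'‖ ^ 2 ≤ ζ⁻¹ ^ 2 * ‖g ω - w‖ ^ 2 := fun ω => by
    rw [← mul_pow, norm_sub_rev (g ω)]
    exact pow_le_pow_left₀ (norm_nonneg _) (norm_le_of_saddlePoint hζ hB hHpd (hJd ω) (hd ω)) 2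
  have hdint : Integrable (fun ω => u ω - u') μ := huint.sub (integrable_const u')
  have hsqint : Integrable (fun ω => ‖u ω - u'‖ ^ 2) μ :=
    (hgvarint.const_mul (ζ⁻¹ ^ 2)).mono' (hdint.aestronglyMeasurable.norm.pow 2)
      (ae_of_all _ fun ω => by
        rw [Real.norm_of_nonneg (sq_nonneg _)]
        exact hbound ω)
  have hvar : ∫ ω, ‖u ω - u'‖ ^ 2 ∂μ ≤ ζ⁻¹ ^ 2 * M := by
    refine (integral_mono hsqint (hgvarint.const_mul _) hbound).trans ?_
    rw [integral_const_mul]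
    gcongr
  refine ⟨humean, hymean, ?_, hvar, fun β hβ => ⟨?_, ?_⟩⟩
  · rw [integral_norm_sq_eq_add huint humean hsqint]
    refine add_le_add ?_ hvar
    rw [inv_mul_eq_div, le_div_iff₀' hζ]
    exact hHpd u' hJu'
  · have hβu : Integrable (fun ω => β • u ω) μ := huint.smul β
    rw [integral_add hβu (integrable_const v), integral_smul, humean]
    simp
  · have hL2 : MemLp (fun ω => ‖u ω - u'‖) 2 μ :=
      (memLp_two_iff_integrable_sq hdint.aestronglyMeasurable.norm).2 hsqint
    simp_rw [add_sub_add_right_eq_sub, ← smul_sub, norm_smul, Real.norm_of_nonneg hβ.le]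
    rw [integral_const_mul, mul_assoc]
    gcongr
    refine (integral_le_sqrt_integral_sq hL2).trans ((Real.sqrt_le_sqrt hvar).trans_eq ?_)
    rw [Real.sqrt_mul (sq_nonneg _), Real.sqrt_sq (inv_nonneg.2 hζ.le)]
end
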